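/- Let C ⊆ ℝ² be a convex set that contains at least one point in each of the nine closed regions [i/3,(i+1)/3] × [j/3,(j+1)/3] for i, j ∈ {0,1,2}. Then the point (1/2, 1/2) lies in C. -/

import Mathlib

/-- A linear functional on a convex set takes every value between two of its values. -/
theorem Convex.exists_linearMap_eq {E : Type*} [AddCommGroup E] [Module ℝ E] {S : Set E}
    (hS : Convex ℝ S) (f : E →ₗ[ℝ] ℝ) {p q : E} (hp : p ∈ S) (hq : q ∈ S) {c : ℝ}
    (hpc : f p ≤ c) (hcq : c ≤ f q) : ∃ z ∈ S, f z = c :=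
  (hS.linear_image f).ordConnected.out (Set.mem_image_of_mem f hp) (Set.mem_image_of_mem f hq)
    ⟨hpc, hcq⟩

/-- A convex set in the plane that meets all four closed quadrants based at `(a, b)`
contains `(a, b)`. -/
theorem Convex.mem_of_mem_quadrants {C : Set (ℝ × ℝ)} (hC : Convex ℝ C) {a b : ℝ}
    {p q r s : ℝ × ℝ} (hp : p ∈ C) (hq : q ∈ C) (hr : r ∈ C) (hs : s ∈ C)
    (hp₁ : p.1 ≤ a) (hp₂ : p.2 ≤ b) (hq₁ : a ≤ q.1) (hq₂ : q.2 ≤ b)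
    (hr₁ : r.1 ≤ a) (hr₂ : b ≤ r.2) (hs₁ : a ≤ s.1) (hs₂ : b ≤ s.2) : (a, b) ∈ C := by
  let x := LinearMap.fst ℝ ℝ ℝ
  let y := LinearMap.snd ℝ ℝ ℝ
  obtain ⟨u, ⟨huC, hub⟩, hua⟩ := (hC.inter (convex_halfSpace_le y.isLinear b)).exists_linearMap_eq
    x ⟨hp, hp₂⟩ ⟨hq, hq₂⟩ hp₁ hq₁
  obtain ⟨v, ⟨hvC, hvb⟩, hva⟩ := (hC.inter (convex_halfSpace_ge y.isLinear b)).exists_linearMap_eq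
    x ⟨hr, hr₂⟩ ⟨hs, hs₂⟩ hr₁ hs₁
  obtain ⟨w, ⟨hwC, hwa⟩, hwb⟩ := (hC.inter (convex_hyperplane x.isLinear a)).exists_linearMap_eq
    y ⟨huC, hua⟩ ⟨hvC, hva⟩ hub hvb
  rwa [show (a, b) = w from Prod.ext hwa.symm hwb.symm]

theorem convex_meets_nine_regions_contains_center
    (C : Set (ℝ × ℝ)) (hC : Convex ℝ C)
    (h : ∀ i j : Fin 3,
      (C ∩ Set.Icc ((i:ℝ)/3) (((i:ℝ)+1)/3) ×ˢ Set.Icc ((j:ℝ)/3) (((j:ℝ)+1)/3)).Nonempty) :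
    ((1/2 : ℝ), (1/2 : ℝ)) ∈ C := by
  obtain ⟨p, hp, ⟨-, hp₁⟩, -, hp₂⟩ := h 0 0
  obtain ⟨q, hq, ⟨hq₁, -⟩, -, hq₂⟩ := h 2 0
  obtain ⟨r, hr, ⟨-, hr₁⟩, hr₂, -⟩ := h 0 2
  obtain ⟨s, hs, ⟨hs₁, -⟩, hs₂, -⟩ := h 2 2
  norm_num at hp₁ hp₂ hq₁ hq₂ hr₁ hr₂ hs₁ hs₂
  apply hC.mem_of_mem_quadrants hp hq hr hs <;> linarith
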